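/- Let ι be a countable index type, let a : ι → ℂ be a family with ∑ᵢ ‖a i‖ < ∞ (absolutely summable), and let λ : ι → ℝ satisfy λ i ≥ 0 for all i. Then the function t ↦ ∑ᵢ exp(−t · λ i) · a i (each such sum being absolutely convergent for t ≥ 0) tends, as t → ∞, to the sum ∑_{i : λ i = 0} a i taken over those indices i with λ i = 0. -/

import Mathlib

open Filter Topology Real

/-- Damping by `exp (-(t * r))` with `t, r ≥ 0` does not increase the norm. -/
theorem norm_exp_neg_mul_mul_le {t r : ℝ} (ht : 0 ≤ t) (hr : 0 ≤ r) (z : ℂ) :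
    ‖Complex.exp (-(t * r)) * z‖ ≤ ‖z‖ := by
  rw [norm_mul, Complex.norm_exp]
  refine mul_le_of_le_one_left (norm_nonneg z) (Real.exp_le_one_iff.mpr ?_)
  simpa using mul_nonneg ht hr

/-- For `r > 0`, the factor `exp (-(t * r))` tends to `0` as `t → ∞`. -/
theorem tendsto_cexp_neg_mul_atTop {r : ℝ} (hr : 0 < r) :
    Tendsto (fun t : ℝ => Complex.exp (-(t * r))) atTop (𝓝 0) := by
  rw [Complex.tendsto_exp_nhds_zero_iff]
  simpa using tendsto_id.atTop_mul_const hr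

/-- Analytic core of Proposition 2: for an absolutely summable family `a : ι → ℂ`
and nonnegative exponents `lam : ι → ℝ`, each sum `∑ᵢ exp (−t · lam i) · a i`
(for `t ≥ 0`) converges absolutely, and as `t → ∞` it tends to the sum of `a i`
over the indices with `lam i = 0`. -/
theorem tsum_exp_neg_smul_tendsto_kernel_sum
    (ι : Type*) [Countable ι] (a : ι → ℂ) (lam : ι → ℝ)
    (ha : Summable fun i => ‖a i‖) (hlam : ∀ i, 0 ≤ lam i) :
    (∀ t : ℝ, 0 ≤ t → Summable fun i => ‖Complex.exp (-(t * lam i)) * a i‖) ∧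
    Tendsto (fun t : ℝ => ∑' i, Complex.exp (-(t * lam i)) * a i) atTop
      (𝓝 (∑' i : {i // lam i = 0}, a i)) := by
  refine ⟨fun t ht => ha.of_nonneg_of_le (fun _ => norm_nonneg _)
    fun i => norm_exp_neg_mul_mul_le ht (hlam i) (a i), ?_⟩
  have hker : ∑' i : {i // lam i = 0}, a i = ∑' i, Set.indicator {i | lam i = 0} a i :=
    tsum_subtype {i | lam i = 0} a
  rw [hker]
  refine tendsto_tsum_of_dominated_convergence ha (fun i => ?_) ?_
  · by_cases hi : lam i = 0
    · simp [hi]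
    · simpa [hi] using
        (tendsto_cexp_neg_mul_atTop ((hlam i).lt_of_ne' hi)).mul_const (a i)
  · filter_upwards [eventually_ge_atTop 0] with t ht i
    exact norm_exp_neg_mul_mul_le ht (hlam i) (a i)
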